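/- arXiv:2407.13436 — 7 statements merged into one kernel-verified Lean document; each statement's English description precedes it below -/
import Mathlib

section
/- Let X and Y be finite sets, let p be a probability mass function on X, and let k(·|x) be a channel with k(y|x) > 0 for all x ∈ X, y ∈ Y. Define the joint distribution P(x,y) = p(x)k(y|x), its marginals p on X and q(y) = Σ_x p(x)k(y|x) on Y, and the symmetrized KL information I_SKL = D(P ‖ p⊗q) + D(p⊗q ‖ P), where D(μ‖ν) = Σ μ log(μ/ν). Then I_SKL = Σ_{x, x̃ ∈ X} p(x) p(x̃) D(k(·|x) ‖ k(·|x̃)), where D(k(·|x) ‖ k(·|x̃)) = Σ_{y ∈ Y} k(y|x) log( k(y|x) / k(y|x̃) ). -/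
open Finset

/-- For a finite input pmf `p` and a strictly positive channel `k`,
the symmetrized KL information `D(P ‖ p⊗q) + D(p⊗q ‖ P)` (with joint `P(x,y) = p x * k x y`
and output marginal `q y = ∑ x, p x * k x y`) equals the double sum
`∑_{x,x̃} p(x) p(x̃) D(k(·|x) ‖ k(·|x̃))`. -/
theorem skl_double_sum_representation
    {X Y : Type*} [Fintype X] [Fintype Y]
    (p : X → ℝ) (hp : ∀ x, 0 ≤ p x) (hp1 : ∑ x, p x = 1)
    (k : X → Y → ℝ) (hk : ∀ x y, 0 < k x y) (hk1 : ∀ x, ∑ y, k x y = 1) :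
    (∑ x, ∑ y, p x * k x y *
        Real.log ((p x * k x y) / (p x * (∑ x', p x' * k x' y))))
      + (∑ x, ∑ y, p x * (∑ x', p x' * k x' y) *
          Real.log ((p x * (∑ x', p x' * k x' y)) / (p x * k x y)))
    = ∑ x, ∑ x', p x * p x' * (∑ y, k x y * Real.log (k x y / k x' y)) := by
  have hq : ∀ y, 0 < ∑ x', p x' * k x' y := by
    intro y
    obtain ⟨x, hx⟩ : ∃ x, p x ≠ 0 := by
      by_contra h
      push Not at h
      simp [h] at hp1
    refine Finset.sum_pos' (fun i _ => mul_nonneg (hp i) (hk i y).le) ⟨x, Finset.mem_univ x, ?_⟩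
    exact mul_pos (lt_of_le_of_ne (hp x) (Ne.symm hx)) (hk x y)
  have hR : ∑ x, ∑ x', p x * p x' * (∑ y, k x y * Real.log (k x y / k x' y))
      = ∑ y, ∑ x, ∑ x', p x * p x' * (k x y * Real.log (k x y / k x' y)) := by
    simp_rw [Finset.mul_sum]
    rw [Finset.sum_comm (s := (Finset.univ : Finset Y))]
    refine Finset.sum_congr rfl fun x _ => ?_
    rw [Finset.sum_comm]
  rw [hR, Finset.sum_comm, Finset.sum_comm (f := fun x y => p x * (∑ x', p x' * k x' y) *
          Real.log ((p x * (∑ x', p x' * k x' y)) / (p x * k x y))), ← Finset.sum_add_distrib]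
  refine Finset.sum_congr rfl fun y _ => ?_
  have hqy := hq y
  generalize hQ : ∑ x', p x' * k x' y = q at hqy ⊢
  have h1 : ∀ x, p x * k x y * Real.log ((p x * k x y) / (p x * q))
      = p x * k x y * Real.log (k x y) - p x * k x y * Real.log q := by
    intro x
    by_cases h : p x = 0
    · simp [h]
    · rw [mul_div_mul_left _ _ h, Real.log_div (hk x y).ne' hqy.ne']; ring
  have h2 : ∀ x, p x * q * Real.log ((p x * q) / (p x * k x y))
      = p x * (q * Real.log q) - q * (p x * Real.log (k x y)) := by
    intro x
    by_cases h : p x = 0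
    · simp [h]
    · rw [mul_div_mul_left _ _ h, Real.log_div hqy.ne' (hk x y).ne']; ring
  have h3 : ∀ x x', p x * p x' * (k x y * Real.log (k x y / k x' y))
      = p x' * (p x * k x y * Real.log (k x y))
        - (p x * k x y) * (p x' * Real.log (k x' y)) := by
    intro x x'
    rw [Real.log_div (hk x y).ne' (hk x' y).ne']; ring
  simp only [h1, h2, h3, Finset.sum_sub_distrib, ← Finset.sum_mul, ← Finset.mul_sum, hp1, hQ]
  ring
end

section
/- Lautum information is not concave in the input distribution for a fixed channel: there exist finite sets X and Y, a channel k(·|·) on X×Y with k(y|x) > 0 for all x, y, two probability mass functions p₀ and p₁ on X, and α ∈ (0,1) such that L((1−α)p₀ + αp₁) < (1−α)L(p₀) + αL(p₁), where for a probability mass function p on X one sets q_p(y) = Σ_x p(x)k(y|x) and L(p) = Σ_{x,y} p(x) q_p(y) log( q_p(y) / k(y|x) ). -/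
open Finset

/-- Lautum information `L(p) = ∑_{x,y} p(x) q_p(y) log(q_p(y) / k(y|x))`,
where `q_p(y) = ∑_x p(x) k(y|x)` is the output marginal. -/
noncomputable def lautum {n m : ℕ} (k : Fin n → Fin m → ℝ) (p : Fin n → ℝ) : ℝ :=
  ∑ x, ∑ y, p x * (∑ x', p x' * k x' y) *
    Real.log ((∑ x', p x' * k x' y) / k x y)

set_option exponentiation.threshold 20000 in
theorem pow_ineq_nat : (23:ℕ)^368 * 233^3728 < 15^2153 * 113^1808 * 2^10240 := by
  norm_num

theorem log_ineq : 368 * Real.log 23 + 3728 * Real.log 233 <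
    2153 * Real.log 15 + 1808 * Real.log 113 + 10240 * Real.log 2 := by
  have h : ((23^368 * 233^3728 : ℕ) : ℝ) < ((15^2153 * 113^1808 * 2^10240 : ℕ) : ℝ) :=
    Nat.cast_lt.mpr pow_ineq_nat
  rw [Nat.cast_mul, Nat.cast_mul, Nat.cast_mul, Nat.cast_pow, Nat.cast_pow, Nat.cast_pow,
    Nat.cast_pow, Nat.cast_pow] at h
  have h2 := Real.log_lt_log (mul_pos (pow_pos (by norm_num) _) (pow_pos (by norm_num) _)) h
  rw [Real.log_mul (pow_ne_zero _ (by norm_num)) (pow_ne_zero _ (by norm_num)),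
    Real.log_mul (mul_ne_zero (pow_ne_zero _ (by norm_num)) (pow_ne_zero _ (by norm_num)))
      (pow_ne_zero _ (by norm_num)),
    Real.log_mul (pow_ne_zero _ (by norm_num)) (pow_ne_zero _ (by norm_num)),
    Real.log_pow, Real.log_pow, Real.log_pow, Real.log_pow, Real.log_pow] at h2
  exact_mod_cast h2

theorem log_div_two_pow (a : ℝ) (ha : a ≠ 0) (n : ℕ) :
    Real.log (a / 2 ^ n) = Real.log a - n * Real.log 2 := by
  rw [Real.log_div ha (by positivity), Real.log_pow]

/-- Lautum information is not concave in the input distribution: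
there is a strictly positive finite channel, two input pmfs `p₀, p₁` and `α ∈ (0,1)`
with `L((1-α) p₀ + α p₁) < (1-α) L(p₀) + α L(p₁)`. -/
theorem lautum_not_concave :
    ∃ (n m : ℕ) (k : Fin n → Fin m → ℝ) (p₀ p₁ : Fin n → ℝ) (α : ℝ),
      (∀ x y, 0 < k x y) ∧ (∀ x, ∑ y, k x y = 1) ∧
      (∀ x, 0 ≤ p₀ x) ∧ (∑ x, p₀ x = 1) ∧
      (∀ x, 0 ≤ p₁ x) ∧ (∑ x, p₁ x = 1) ∧
      0 < α ∧ α < 1 ∧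
      lautum k (fun x => (1 - α) * p₀ x + α * p₁ x)
        < (1 - α) * lautum k p₀ + α * lautum k p₁ := by
  refine ⟨2, 2, ![![1/16, 15/16], ![1/2, 1/2]], ![1, 0], ![7/8, 1/8], 1/2, ?_, ?_, ?_, ?_, ?_, ?_,
    by norm_num, by norm_num, ?_⟩
  · intro x y; fin_cases x <;> fin_cases y <;> norm_num
  · intro x; fin_cases x <;> norm_num [Fin.sum_univ_two]
  · intro x; fin_cases x <;> norm_num
  · norm_num [Fin.sum_univ_two]
  · intro x; fin_cases x <;> norm_num
  · norm_num [Fin.sum_univ_two]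
  · have e1 : Real.log (15/8) = Real.log 15 - 3 * Real.log 2 := by
      have := log_div_two_pow 15 (by norm_num) 3; norm_num at this; exact this
    have e2 : Real.log (15/64) = Real.log 15 - 6 * Real.log 2 := by
      have := log_div_two_pow 15 (by norm_num) 6; norm_num at this; exact this
    have e3 : Real.log (113/64) = Real.log 113 - 6 * Real.log 2 := by
      have := log_div_two_pow 113 (by norm_num) 6; norm_num at this; exact this
    have e4 : Real.log (113/120) = Real.log 113 - Real.log 15 - 3 * Real.log 2 := by
      have := log_div_two_pow (113/15) (by norm_num) 3
      rw [Real.log_div (x := 113) (y := 15) (by norm_num) (by norm_num)] at this; norm_num at this; exact this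
    have e5 : Real.log (23/16) = Real.log 23 - 4 * Real.log 2 := by
      have := log_div_two_pow 23 (by norm_num) 4; norm_num at this; exact this
    have e6 : Real.log (23/128) = Real.log 23 - 7 * Real.log 2 := by
      have := log_div_two_pow 23 (by norm_num) 7; norm_num at this; exact this
    have e7 : Real.log (233/128) = Real.log 233 - 7 * Real.log 2 := by
      have := log_div_two_pow 233 (by norm_num) 7; norm_num at this; exact this
    have e8 : Real.log (233/240) = Real.log 233 - Real.log 15 - 4 * Real.log 2 := by
      have := log_div_two_pow (233/15) (by norm_num) 4
      rw [Real.log_div (x := 233) (y := 15) (by norm_num) (by norm_num)] at this; norm_num at this; exact this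
    have key := log_ineq
    norm_num [lautum, Fin.sum_univ_two]
    rw [e1, e2, e3, e4, e5, e6, e7, e8]
    linarith
end

section
/- Let C be a symmetric d×d real matrix with all entries C_{ij} ≥ 0, and let x ∈ ℝ^d satisfy Σ_{i=1}^d x_i = 1, x_i > 0 for all i, and xᵀCx > 0. Define the updated vector x′ by x′_i = x_i (Cx)_i / (xᵀCx) for each i. Then (x′)ᵀ C x′ ≥ xᵀ C x. -/
open Finset

/-- For a symmetric nonnegative matrix `C` and a point `x` of the
probability simplex with strictly positive entries and `xᵀCx > 0`, the Max-SKL update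
`x′_i = x_i (Cx)_i / (xᵀCx)` does not decrease the quadratic form: `(x′)ᵀCx′ ≥ xᵀCx`. -/
theorem maxskl_update_nondecreasing {d : ℕ}
    (C : Matrix (Fin d) (Fin d) ℝ) (hsym : C.IsSymm) (hC : ∀ i j, 0 ≤ C i j)
    (x : Fin d → ℝ) (hxpos : ∀ i, 0 < x i) (hx1 : ∑ i, x i = 1)
    (hQ : 0 < ∑ i, ∑ j, C i j * x i * x j)
    (x' : Fin d → ℝ)
    (hx' : ∀ i, x' i =
      x i * (∑ j, C i j * x j) / (∑ i', ∑ j, C i' j * x i' * x j)) :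
    ∑ i, ∑ j, C i j * x i * x j ≤ ∑ i, ∑ j, C i j * x' i * x' j := by
  set Q := ∑ i, ∑ j, C i j * x i * x j with hQdef
  obtain ⟨s, hs⟩ : ∃ s : Fin d → ℝ, ∀ i, s i = (∑ j, C i j * x j) / Q := ⟨_, fun _ => rfl⟩
  have hQ0 : Q ≠ 0 := hQ.ne'
  have hr : ∀ i, ∑ j, C i j * x j = Q * s i := fun i => by
    rw [hs]; field_simp
  have hxs : ∀ i, x' i = x i * s i := fun i => by
    rw [hx', hs, mul_div_assoc]
  have hs0 : ∀ i, 0 ≤ s i := fun i => by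
    rw [hs]
    exact div_nonneg (Finset.sum_nonneg fun j _ => mul_nonneg (hC i j) (hxpos j).le) hQ.le
  have hrow : ∀ i, ∑ j, C i j * x i * x j = Q * (x i * s i) := fun i => by
    have : ∑ j, C i j * x i * x j = x i * ∑ j, C i j * x j := by
      rw [Finset.mul_sum]
      exact Finset.sum_congr rfl fun j _ => by ring
    rw [this, hr]; ring
  have hsum : ∑ i, x i * s i = 1 := by
    have h : Q = Q * ∑ i, x i * s i := by
      rw [Finset.mul_sum, ← Finset.sum_congr rfl fun i _ => hrow i]
    have h2 : Q * (∑ i, x i * s i) = Q * 1 := by linarith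
    exact mul_left_cancel₀ hQ0 h2
  have hzero : ∀ i j, s i = 0 → C i j = 0 := fun i j h => by
    have h1 := hr i
    rw [h, mul_zero, Finset.sum_eq_zero_iff_of_nonneg
      (fun j _ => mul_nonneg (hC i j) (hxpos j).le)] at h1
    exact (mul_eq_zero.1 (h1 j (Finset.mem_univ j))).resolve_right (hxpos j).ne'
  have hpt : ∀ i j, C i j * x i * x j + C i j * x i * x j * Real.log (s i)
      + C j i * x j * x i * Real.log (s j) ≤ C i j * x' i * x' j := fun i j => by
    have hji : C j i = C i j := hsym.apply i j
    rw [hxs, hxs, hji]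
    rcases (hs0 i).eq_or_lt with h | hi
    · rw [hzero i j h.symm]; simp
    rcases (hs0 j).eq_or_lt with h | hj
    · rw [← hji, hzero j i h.symm]; simp
    have hl := Real.log_le_sub_one_of_pos (mul_pos hi hj)
    rw [Real.log_mul hi.ne' hj.ne'] at hl
    have hw : 0 ≤ C i j * x i * x j :=
      mul_nonneg (mul_nonneg (hC i j) (hxpos i).le) (hxpos j).le
    nlinarith [mul_le_mul_of_nonneg_left hl hw]
  have hL : 0 ≤ ∑ i, ∑ j, C i j * x i * x j * Real.log (s i) := by
    have h1 : ∀ i, Q * (x i * s i - x i) ≤ ∑ j, C i j * x i * x j * Real.log (s i) := fun i => by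
      rw [← Finset.sum_mul, hrow]
      have h2 : s i - 1 ≤ s i * Real.log (s i) := by
        rcases (hs0 i).eq_or_lt with h | hi
        · rw [← h]; simp
        have h3 := Real.one_sub_inv_le_log_of_pos hi
        have h4 := mul_le_mul_of_nonneg_left h3 hi.le
        rwa [mul_sub, mul_inv_cancel₀ hi.ne', mul_one] at h4
      have h5 := mul_le_mul_of_nonneg_left h2 (mul_pos hQ (hxpos i)).le
      linarith
    have h6 := Finset.sum_le_sum fun i (_ : i ∈ Finset.univ) => h1 i
    rw [← Finset.mul_sum, Finset.sum_sub_distrib, hsum, hx1, sub_self, mul_zero] at h6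
    exact h6
  have hfin := Finset.sum_le_sum fun i (_ : i ∈ Finset.univ) =>
    Finset.sum_le_sum fun j (_ : j ∈ Finset.univ) => hpt i j
  simp only [Finset.sum_add_distrib] at hfin
  have hcomm : ∑ i, ∑ j, C j i * x j * x i * Real.log (s j)
      = ∑ i, ∑ j, C i j * x i * x j * Real.log (s i) := Finset.sum_comm
  rw [hcomm] at hfin
  linarith
end

section
/- Let C be a symmetric d×d real matrix with all entries C_{ij} ≥ 0, and let (x_k)_{k≥0} be a sequence in the probability simplex with all entries of x₀ positive such that for every k, x_kᵀCx_k > 0 and x_{k+1} is given by the update (x_{k+1})_i = (x_k)_i (Cx_k)_i / (x_kᵀCx_k). Then the sequence of values v_k = x_kᵀCx_k is nondecreasing, bounded above by max_{i,j} C_{ij}, and hence converges to a limit in ℝ. -/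
open Finset

theorem aux_amgm (s t : ℝ) (hs : 0 < s) (ht : 0 < t) : 3 - 1 / s - 1 / t ≤ s * t := by
  have key : (s - 1) * (t - 1) ≤ (s * t - 1) ^ 2 := by
    rcases le_total 1 s with h1 | h1 <;> rcases le_total 1 t with h2 | h2
    · have a1 : s - 1 ≤ s * t - 1 := by nlinarith
      have a2 : t - 1 ≤ s * t - 1 := by nlinarith
      have := mul_le_mul a1 a2 (by linarith) (by linarith)
      nlinarith
    · nlinarith [sq_nonneg (s * t - 1), mul_nonneg (sub_nonneg.2 h1) (sub_nonneg.2 h2)]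
    · nlinarith [sq_nonneg (s * t - 1), mul_nonneg (sub_nonneg.2 h1) (sub_nonneg.2 h2)]
    · have a1 : 1 - s ≤ 1 - s * t := by nlinarith
      have a2 : 1 - t ≤ 1 - s * t := by nlinarith
      have := mul_le_mul a1 a2 (by linarith) (by linarith)
      nlinarith
  have e : s * t - (3 - 1 / s - 1 / t) = ((s * t - 1) ^ 2 - (s - 1) * (t - 1)) / (s * t) := by
    field_simp
    ring
  have : 0 ≤ s * t - (3 - 1 / s - 1 / t) := by
    rw [e]
    exact div_nonneg (by linarith) (by positivity)
  linarith

theorem aux_step {d : ℕ} (C : Matrix (Fin d) (Fin d) ℝ) (hsym : C.IsSymm)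
    (hC : ∀ i j, 0 ≤ C i j) (x g : Fin d → ℝ) (v : ℝ) (hx : ∀ i, 0 ≤ x i)
    (h1 : ∑ i, x i = 1) (hg : ∀ i, g i = ∑ j, C i j * x j)
    (hv : v = ∑ i, ∑ j, C i j * x i * x j) (hpos : 0 < v) :
    v ^ 3 ≤ ∑ i, ∑ j, C i j * x i * x j * (g i * g j) := by
  have hg0 : ∀ i, 0 ≤ g i := fun i => by
    rw [hg]; exact Finset.sum_nonneg fun j _ => mul_nonneg (hC i j) (hx j)
  have hle : ∀ i j, C i j * x j ≤ g i := fun i j => by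
    rw [hg]
    exact Finset.single_le_sum (f := fun j => C i j * x j)
      (fun j _ => mul_nonneg (hC i j) (hx j)) (Finset.mem_univ j)
  have pt : ∀ i j, C i j * x i * x j * (v ^ 2 * (3 - v / g i - v / g j))
      ≤ C i j * x i * x j * (g i * g j) := by
    intro i j
    have hw : 0 ≤ C i j * x i * x j := mul_nonneg (mul_nonneg (hC i j) (hx i)) (hx j)
    rcases hw.eq_or_lt with h | h
    · rw [← h]; simp
    · have hCp : 0 < C i j := (hC i j).lt_of_ne' (fun h0 => by simp [h0] at h)
      have hxi : 0 < x i := (hx i).lt_of_ne' (fun h0 => by simp [h0] at h)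
      have hxj : 0 < x j := (hx j).lt_of_ne' (fun h0 => by simp [h0] at h)
      have gi : 0 < g i := lt_of_lt_of_le (mul_pos hCp hxj) (hle i j)
      have gj : 0 < g j := by
        refine lt_of_lt_of_le (mul_pos ?_ hxi) (hle j i)
        rw [hsym.apply]; exact hCp
      refine mul_le_mul_of_nonneg_left ?_ hw
      have := mul_le_mul_of_nonneg_left
        (aux_amgm (g i / v) (g j / v) (by positivity) (by positivity)) (sq_nonneg v)
      rw [one_div_div, one_div_div] at this
      refine this.trans (le_of_eq ?_)
      field_simp
  have row : ∀ i, ∑ j, C i j * x i * x j * (v / g i) ≤ x i * v := by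
    intro i
    have : ∑ j, C i j * x i * x j * (v / g i) = x i * (g i * (v / g i)) := by
      rw [hg i, Finset.sum_mul, Finset.mul_sum]
      exact Finset.sum_congr rfl fun j _ => by ring
    rw [this]
    refine mul_le_mul_of_nonneg_left ?_ (hx i)
    rcases (hg0 i).eq_or_lt with h | h
    · rw [← h]; simpa using hpos.le
    · rw [mul_div_cancel₀ _ h.ne']
  have A : ∑ i, ∑ j, C i j * x i * x j * (v / g i) ≤ v := by
    refine (Finset.sum_le_sum fun i _ => row i).trans ?_
    rw [← Finset.sum_mul, h1, one_mul]
  have B : ∑ i, ∑ j, C i j * x i * x j * (v / g j) ≤ v := by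
    rw [Finset.sum_comm]
    refine le_trans (le_of_eq ?_) A
    refine Finset.sum_congr rfl fun i _ => Finset.sum_congr rfl fun j _ => ?_
    rw [hsym.apply]; ring
  have S : ∑ i, ∑ j, C i j * x i * x j * (v ^ 2 * (3 - v / g i - v / g j))
      = v ^ 2 * (3 * v - ∑ i, ∑ j, C i j * x i * x j * (v / g i)
        - ∑ i, ∑ j, C i j * x i * x j * (v / g j)) := by
    have e3 : 3 * v = ∑ i, ∑ j, 3 * (C i j * x i * x j) := by
      simp only [← Finset.mul_sum, ← hv]
    rw [e3]
    simp only [← Finset.sum_sub_distrib, Finset.mul_sum (a := v ^ 2)]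
    refine Finset.sum_congr rfl fun i _ => ?_
    refine Finset.sum_congr rfl fun j _ => ?_
    ring
  refine le_trans ?_ (Finset.sum_le_sum fun i _ => Finset.sum_le_sum fun j _ => pt i j)
  rw [S]
  have := mul_le_mul_of_nonneg_left (show v ≤ 3 * v
    - ∑ i, ∑ j, C i j * x i * x j * (v / g i)
    - ∑ i, ∑ j, C i j * x i * x j * (v / g j) by linarith) (sq_nonneg v)
  calc v ^ 3 = v ^ 2 * v := by ring
    _ ≤ _ := this

/-- For a symmetric nonnegative matrix `C` and a Max-SKL iteration
sequence `(x_k)` in the probability simplex, starting from a strictly positive `x₀`, with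
all quadratic forms positive, the values `v_k = x_kᵀCx_k` are nondecreasing, bounded above
by `max_{i,j} C_{ij}`, and hence converge to a real limit. -/
theorem maxskl_values_converge {d : ℕ}
    (C : Matrix (Fin d) (Fin d) ℝ) (hsym : C.IsSymm) (hC : ∀ i j, 0 ≤ C i j)
    (x : ℕ → Fin d → ℝ)
    (hx0 : ∀ i, 0 < x 0 i)
    (hsimplex : ∀ k, (∀ i, 0 ≤ x k i) ∧ ∑ i, x k i = 1)
    (hQpos : ∀ k, 0 < ∑ i, ∑ j, C i j * x k i * x k j)
    (hupd : ∀ k i, x (k + 1) i =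
      x k i * (∑ j, C i j * x k j) / (∑ i', ∑ j, C i' j * x k i' * x k j)) :
    Monotone (fun k => ∑ i, ∑ j, C i j * x k i * x k j) ∧
    (∀ k, ∑ i, ∑ j, C i j * x k i * x k j ≤ ⨆ i, ⨆ j, C i j) ∧
    ∃ l : ℝ, Filter.Tendsto (fun k => ∑ i, ∑ j, C i j * x k i * x k j)
      Filter.atTop (nhds l) := by
  have hmono : Monotone (fun k => ∑ i, ∑ j, C i j * x k i * x k j) := by
    refine monotone_nat_of_le_succ fun k => ?_
    show ∑ i, ∑ j, C i j * x k i * x k j ≤ ∑ i, ∑ j, C i j * x (k + 1) i * x (k + 1) j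
    have hp := hQpos k
    have hst := aux_step C hsym hC (x k) (fun i => ∑ j, C i j * x k j) _ (hsimplex k).1
      (hsimplex k).2 (fun _ => rfl) rfl hp
    have hu := hupd k
    generalize hv : ∑ i, ∑ j, C i j * x k i * x k j = v at hp hst hu ⊢
    have e : ∑ i, ∑ j, C i j * x (k + 1) i * x (k + 1) j =
        (∑ i, ∑ j, C i j * x k i * x k j *
          ((∑ j, C i j * x k j) * (∑ l, C j l * x k l))) / v ^ 2 := by
      rw [Finset.sum_div]
      refine Finset.sum_congr rfl fun i _ => ?_
      rw [Finset.sum_div]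
      refine Finset.sum_congr rfl fun j _ => ?_
      rw [hu i, hu j]
      field_simp
    rw [e, le_div_iff₀ (by positivity)]
    calc v * v ^ 2 = v ^ 3 := by ring
      _ ≤ _ := hst
  have hbd : ∀ k, ∑ i, ∑ j, C i j * x k i * x k j ≤ ⨆ i, ⨆ j, C i j := by
    intro k
    have hM : ∀ i j, C i j ≤ ⨆ i, ⨆ j, C i j := fun i j =>
      (le_ciSup (f := fun j => C i j) (Set.finite_range _).bddAbove j).trans
        (le_ciSup (f := fun i => ⨆ j, C i j) (Set.finite_range _).bddAbove i)
    generalize (⨆ i, ⨆ j, C i j) = M at hM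
    obtain ⟨h0, h1⟩ := hsimplex k
    calc ∑ i, ∑ j, C i j * x k i * x k j ≤ ∑ i, ∑ j, M * x k i * x k j :=
          Finset.sum_le_sum fun i _ => Finset.sum_le_sum fun j _ =>
            mul_le_mul_of_nonneg_right (mul_le_mul_of_nonneg_right (hM i j) (h0 i)) (h0 j)
      _ = M := by simp only [← Finset.mul_sum, h1, mul_one]
  exact ⟨hmono, hbd, _, tendsto_atTop_ciSup hmono
    ⟨_, by rintro _ ⟨k, rfl⟩; exact hbd k⟩⟩
end

section
/- Consider a binary-input channel: a finite output set Y and two probability mass functions P₀, P₁ on Y with P₀(y) > 0 and P₁(y) > 0 for all y. For the input distribution assigning probability q ∈ [0,1] to input 0 and 1−q to input 1, the symmetrized KL information equals I_SKL(q) = q(1−q) [ D(P₀‖P₁) + D(P₁‖P₀) ]. Consequently, the maximum of I_SKL(q) over q ∈ [0,1] is attained at q = 1/2 and equals (1/4)[ D(P₀‖P₁) + D(P₁‖P₀) ]. -/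
open Finset

/-- The symmetrized KL information `D(P ‖ P_X ⊗ P_Y) + D(P_X ⊗ P_Y ‖ P)` of the joint
distribution `P(x, y) = p(x) P_x(y)` of a binary-input channel with conditional laws
`P₀, P₁` on `Y` and input distribution `p(0) = q`, `p(1) = 1 - q`. -/
noncomputable def binarySKL {Y : Type*} [Fintype Y] (P₀ P₁ : Y → ℝ) (q : ℝ) : ℝ :=
  ∑ x : Fin 2, ∑ y : Y,
    ((![q, 1 - q] x * ![P₀, P₁] x y) *
        Real.log ((![q, 1 - q] x * ![P₀, P₁] x y) /
          (![q, 1 - q] x * (q * P₀ y + (1 - q) * P₁ y)))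
      + (![q, 1 - q] x * (q * P₀ y + (1 - q) * P₁ y)) *
        Real.log ((![q, 1 - q] x * (q * P₀ y + (1 - q) * P₁ y)) /
          (![q, 1 - q] x * ![P₀, P₁] x y)))

/-- For a binary-input channel with full-support conditional pmfs
`P₀, P₁` and input probability `q ∈ [0,1]` on input `0`, the symmetrized KL information
equals `q (1-q) [D(P₀‖P₁) + D(P₁‖P₀)]`; consequently its maximum over `q ∈ [0,1]` is
attained at `q = 1/2` with value `(1/4)[D(P₀‖P₁) + D(P₁‖P₀)]`. -/
theorem binary_input_skl {Y : Type*} [Fintype Y]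
    (P₀ P₁ : Y → ℝ) (h₀ : ∀ y, 0 < P₀ y) (h₁ : ∀ y, 0 < P₁ y)
    (h₀1 : ∑ y, P₀ y = 1) (h₁1 : ∑ y, P₁ y = 1) :
    (∀ q ∈ Set.Icc (0 : ℝ) 1,
      binarySKL P₀ P₁ q = q * (1 - q) *
        ((∑ y, P₀ y * Real.log (P₀ y / P₁ y))
          + (∑ y, P₁ y * Real.log (P₁ y / P₀ y)))) ∧
    binarySKL P₀ P₁ (1 / 2) =
      (1 / 4) * ((∑ y, P₀ y * Real.log (P₀ y / P₁ y))
        + (∑ y, P₁ y * Real.log (P₁ y / P₀ y))) ∧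
    (∀ q ∈ Set.Icc (0 : ℝ) 1, binarySKL P₀ P₁ q ≤ binarySKL P₀ P₁ (1 / 2)) := by
  have key : ∀ q ∈ Set.Icc (0 : ℝ) 1,
      binarySKL P₀ P₁ q = q * (1 - q) *
        ((∑ y, P₀ y * Real.log (P₀ y / P₁ y))
          + (∑ y, P₁ y * Real.log (P₁ y / P₀ y))) := by
    rintro q ⟨hq0, hq1⟩
    unfold binarySKL
    rw [Fin.sum_univ_two, ← Finset.sum_add_distrib, ← Finset.sum_add_distrib, Finset.mul_sum]
    refine Finset.sum_congr rfl fun y _ => ?_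
    have ha := h₀ y
    have hb := h₁ y
    have hm : 0 < q * P₀ y + (1 - q) * P₁ y := by
      rcases hq0.eq_or_lt with h | h
      · rw [← h]; simpa using hb
      · have := mul_pos h ha
        have := mul_nonneg (sub_nonneg.2 hq1) hb.le
        linarith
    have term : ∀ c a m : ℝ, 0 < a → 0 < m →
        (c * a) * Real.log ((c * a) / (c * m)) + (c * m) * Real.log ((c * m) / (c * a))
          = c * ((a - m) * (Real.log a - Real.log m)) := by
      intro c a m ha hm
      by_cases hc : c = 0
      · simp [hc]
      · rw [mul_div_mul_left _ _ hc, mul_div_mul_left _ _ hc,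
          Real.log_div ha.ne' hm.ne', Real.log_div hm.ne' ha.ne']
        ring
    simp only [Matrix.cons_val_zero, Matrix.cons_val_one]
    rw [term _ _ _ ha hm, term _ _ _ hb hm, Real.log_div ha.ne' hb.ne',
      Real.log_div hb.ne' ha.ne']
    ring
  have hnn : 0 ≤ (∑ y, P₀ y * Real.log (P₀ y / P₁ y))
      + (∑ y, P₁ y * Real.log (P₁ y / P₀ y)) := by
    rw [← Finset.sum_add_distrib]
    refine Finset.sum_nonneg fun y _ => ?_
    have ha := h₀ y
    have hb := h₁ y
    rw [Real.log_div ha.ne' hb.ne', Real.log_div hb.ne' ha.ne']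
    have : 0 ≤ (P₀ y - P₁ y) * (Real.log (P₀ y) - Real.log (P₁ y)) := by
      rcases le_total (P₀ y) (P₁ y) with h | h
      · exact mul_nonneg_of_nonpos_of_nonpos (sub_nonpos.2 h)
          (sub_nonpos.2 (Real.log_le_log ha h))
      · exact mul_nonneg (sub_nonneg.2 h) (sub_nonneg.2 (Real.log_le_log hb h))
    linarith
  have half : binarySKL P₀ P₁ (1 / 2) =
      (1 / 4) * ((∑ y, P₀ y * Real.log (P₀ y / P₁ y))
        + (∑ y, P₁ y * Real.log (P₁ y / P₀ y))) := by
    rw [key (1 / 2) ⟨by norm_num, by norm_num⟩]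
    norm_num
  refine ⟨key, half, fun q hq => ?_⟩
  rw [half, key q hq]
  refine mul_le_mul_of_nonneg_right ?_ hnn
  nlinarith [sq_nonneg (q - 1 / 2)]
end

section
/- Let W and S be finite sets, π a probability mass function on W with π(w) > 0 for all w, P_S a probability mass function on S with P_S(s) > 0 for all s, γ > 0, and f : W × S → ℝ a loss function. Define the Gibbs channel P_{W|S}(w|s) = π(w) e^{−γ f(w,s)} / Z(s) with Z(s) = Σ_{w'} π(w') e^{−γ f(w',s)}, the joint distribution P(w,s) = P_S(s) P_{W|S}(w|s), and its marginal P_W on W. Then the symmetrized KL information satisfies I_SKL(W;S) = γ ( Σ_{w,s} P_W(w) P_S(s) f(w,s) − Σ_{w,s} P(w,s) f(w,s) ); i.e., I_SKL(W;S)/γ equals the gap between the expected loss under the product of marginals and under the joint distribution. -/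
open Finset

/-- For the Gibbs channel
`P_{W|S}(w|s) = μ(w) e^{-γ f(w,s)} / Z(s)` with full-support prior `μ`, full-support data
distribution `P_S`, inverse temperature `γ > 0` and loss `f`, the symmetrized KL
information between `W` and `S` equals `γ` times the gap between the expected loss under
the product of the marginals and under the joint distribution. -/
theorem gibbs_skl_generalization {W S : Type*} [Fintype W] [Fintype S]
    (μ : W → ℝ) (hμ : ∀ w, 0 < μ w) (hμ1 : ∑ w, μ w = 1)
    (PS : S → ℝ) (hPS : ∀ s, 0 < PS s) (hPS1 : ∑ s, PS s = 1)
    (γ : ℝ) (hγ : 0 < γ) (f : W → S → ℝ)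
    (P : W → S → ℝ)
    (hP : ∀ w s, P w s = PS s * (μ w * Real.exp (-γ * f w s) /
        ∑ w', μ w' * Real.exp (-γ * f w' s)))
    (PW : W → ℝ) (hPW : ∀ w, PW w = ∑ s, P w s) :
    (∑ w, ∑ s, (P w s * Real.log (P w s / (PW w * PS s))
        + PW w * PS s * Real.log ((PW w * PS s) / P w s)))
      = γ * ((∑ w, ∑ s, PW w * PS s * f w s) - (∑ w, ∑ s, P w s * f w s)) := by
  have hW : Nonempty W := by
    by_contra h
    rw [not_nonempty_iff] at h
    simp at hμ1
  have hS : Nonempty S := by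
    by_contra h
    rw [not_nonempty_iff] at h
    simp at hPS1
  obtain ⟨Z, hZ⟩ : ∃ Z : S → ℝ, ∀ s, Z s = ∑ w', μ w' * Real.exp (-γ * f w' s) :=
    ⟨_, fun _ => rfl⟩
  have hZpos : ∀ s, 0 < Z s := fun s => by
    rw [hZ]
    exact Finset.sum_pos (fun w _ => mul_pos (hμ w) (Real.exp_pos _)) Finset.univ_nonempty
  simp only [← hZ] at hP
  have hPpos : ∀ w s, 0 < P w s := fun w s => by
    rw [hP]
    exact mul_pos (hPS s) (div_pos (mul_pos (hμ w) (Real.exp_pos _)) (hZpos s))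
  have hPWpos : ∀ w, 0 < PW w := fun w => by
    rw [hPW]
    exact Finset.sum_pos (fun s _ => hPpos w s) Finset.univ_nonempty
  have hcol : ∀ s, ∑ w, P w s = PS s := fun s => by
    simp only [hP]
    rw [← Finset.mul_sum, ← Finset.sum_div, ← hZ, div_self (hZpos s).ne', mul_one]
  have hPW1 : ∑ w, PW w = 1 := by
    simp only [hPW]
    rw [Finset.sum_comm]
    simp only [hcol, hPS1]
  have hlogP : ∀ w s, Real.log (P w s)
      = Real.log (PS s) + (Real.log (μ w) + -γ * f w s - Real.log (Z s)) := fun w s => by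
    have h1 := (hPS s).ne'
    have h2 := (hμ w).ne'
    have h3 := (hZpos s).ne'
    have h4 := (Real.exp_pos (-γ * f w s)).ne'
    rw [hP, Real.log_mul h1 (div_ne_zero (mul_ne_zero h2 h4) h3),
      Real.log_div (mul_ne_zero h2 h4) h3, Real.log_mul h2 h4, Real.log_exp]
  have hterm : ∀ w s, P w s * Real.log (P w s / (PW w * PS s))
        + PW w * PS s * Real.log ((PW w * PS s) / P w s)
      = (P w s - PW w * PS s) * (Real.log (μ w) - Real.log (PW w))
        - (P w s - PW w * PS s) * Real.log (Z s)
        + γ * (PW w * PS s * f w s - P w s * f w s) := fun w s => by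
    have h1 := (hPS s).ne'
    have h2 := (hPWpos w).ne'
    have h3 := (hPpos w s).ne'
    rw [Real.log_div h3 (mul_ne_zero h2 h1), Real.log_div (mul_ne_zero h2 h1) h3,
      Real.log_mul h2 h1, hlogP]
    ring
  have hA : ∑ w, ∑ s, (P w s - PW w * PS s) * (Real.log (μ w) - Real.log (PW w)) = 0 := by
    refine Finset.sum_eq_zero fun w _ => ?_
    rw [← Finset.sum_mul, Finset.sum_sub_distrib, ← Finset.mul_sum, hPS1, ← hPW]
    ring
  have hB : ∑ w, ∑ s, (P w s - PW w * PS s) * Real.log (Z s) = 0 := by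
    rw [Finset.sum_comm]
    refine Finset.sum_eq_zero fun s _ => ?_
    rw [← Finset.sum_mul, Finset.sum_sub_distrib, ← Finset.sum_mul, hPW1, hcol]
    ring
  simp only [hterm, Finset.sum_add_distrib, Finset.sum_sub_distrib] at hA hB ⊢
  simp only [← Finset.mul_sum, Finset.sum_sub_distrib] at hA hB ⊢
  linarith
end

section
/- Let X and Y be finite sets, p a probability mass function on X, and k(·|·) a channel with k(y|x) > 0 for all x, y. Define the joint distribution P(x,y) = p(x)k(y|x), the output marginal q(y) = Σ_x p(x)k(y|x), and the symmetrized KL information I_SKL = D(P ‖ p⊗q) + D(p⊗q ‖ P). Then I_SKL = Σ_{x,y} p(x) k(y|x) log k(y|x) − Σ_{x, x̃, y} p(x) p(x̃) k(y|x̃) log k(y|x). -/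
open Finset

/-- For a finite input pmf `p` and a strictly positive channel `k`,
the symmetrized KL information `D(P ‖ p⊗q) + D(p⊗q ‖ P)` (with joint
`P(x,y) = p x * k x y` and output marginal `q y = ∑ x, p x * k x y`) equals
`∑_{x,y} p(x) k(y|x) log k(y|x) − ∑_{x,x̃,y} p(x) p(x̃) k(y|x̃) log k(y|x)`. -/
theorem skl_intermediate_identity {X Y : Type*} [Fintype X] [Fintype Y]
    (p : X → ℝ) (hp : ∀ x, 0 ≤ p x) (hp1 : ∑ x, p x = 1)
    (k : X → Y → ℝ) (hk : ∀ x y, 0 < k x y) (hk1 : ∀ x, ∑ y, k x y = 1) :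
    (∑ x, ∑ y, p x * k x y *
        Real.log ((p x * k x y) / (p x * (∑ x', p x' * k x' y))))
      + (∑ x, ∑ y, p x * (∑ x', p x' * k x' y) *
          Real.log ((p x * (∑ x', p x' * k x' y)) / (p x * k x y)))
    = (∑ x, ∑ y, p x * k x y * Real.log (k x y))
      - (∑ x, ∑ x', ∑ y, p x * p x' * k x' y * Real.log (k x y)) := by
  have hq : ∀ y, 0 < ∑ x', p x' * k x' y := by
    intro y
    refine lt_of_le_of_ne (Finset.sum_nonneg fun x _ => mul_nonneg (hp x) (hk x y).le) ?_
    intro h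
    have h0 := (Finset.sum_eq_zero_iff_of_nonneg
      (fun x _ => mul_nonneg (hp x) (hk x y).le)).1 h.symm
    have h1 : ∑ x, p x = 0 := Finset.sum_eq_zero fun x hx =>
      (mul_eq_zero.1 (h0 x hx)).resolve_right (hk x y).ne'
    linarith
  have hT : (∑ x, ∑ x', ∑ y, p x * p x' * k x' y * Real.log (k x y))
      = ∑ x, ∑ y, p x * (∑ x', p x' * k x' y) * Real.log (k x y) := by
    refine Finset.sum_congr rfl fun x _ => ?_
    rw [Finset.sum_comm]
    refine Finset.sum_congr rfl fun y _ => ?_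
    rw [Finset.mul_sum, Finset.sum_mul]
    exact Finset.sum_congr rfl fun x' _ => by ring
  rw [hT]
  generalize hqd : (fun y => ∑ x', p x' * k x' y) = q
  have hqy : ∀ y, ∑ x', p x' * k x' y = q y := fun y => congrFun hqd y
  simp only [hqy] at hq ⊢
  have e1 : ∀ x y, p x * k x y * Real.log ((p x * k x y) / (p x * q y))
      = p x * k x y * Real.log (k x y) - p x * k x y * Real.log (q y) := by
    intro x y
    by_cases h : p x = 0
    · simp [h]
    · rw [mul_div_mul_left _ _ h, Real.log_div (hk x y).ne' (hq y).ne']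
      ring
  have e2 : ∀ x y, p x * q y * Real.log ((p x * q y) / (p x * k x y))
      = p x * q y * Real.log (q y) - p x * q y * Real.log (k x y) := by
    intro x y
    by_cases h : p x = 0
    · simp [h]
    · rw [mul_div_mul_left _ _ h, Real.log_div (hq y).ne' (hk x y).ne']
      ring
  have e3 : ∑ x, ∑ y, p x * k x y * Real.log (q y)
      = ∑ x, ∑ y, p x * q y * Real.log (q y) := by
    rw [Finset.sum_comm, Finset.sum_comm (f := fun x y => p x * q y * Real.log (q y))]
    refine Finset.sum_congr rfl fun y _ => ?_
    rw [← Finset.sum_mul, ← Finset.sum_mul, ← Finset.sum_mul, hqy, hp1, one_mul]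
  simp only [e1, e2, Finset.sum_sub_distrib]
  linarith
end
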